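/- arXiv:1804.01281 — 2 statements merged into one kernel-verified Lean document; each statement's English description precedes it below -/
import Mathlib

section
/- Let N = kn + r with integers k ≥ 0 and 0 < r < n, let J ⊆ {1,…,d} and let s : J → {0,…,k−1} be any function. Then n · |(C_J + n·v_{J,s}) ∩ 𝒜^{(α)}| = n · |C_J ∩ 𝒜^{(α)}| = θ_J^{(α)}(r) · g_J · n^{|J|}. -/
open Finset

/-- `gJ n t J = gcd({t_j : j ∈ J} ∪ {n})`, so `gJ n t ∅ = n`. -/
def gJ {d : ℕ} (n : ℕ) (t : Fin d → ℕ) (J : Finset (Fin d)) : ℕ :=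
  Nat.gcd (J.gcd t) n

/-- `theta n t α J r` is the number of tuples `(a_ℓ)_{ℓ ∉ J}` of integers with
`0 ≤ a_ℓ ≤ r − 1` and `∑_{ℓ ∉ J} t_ℓ a_ℓ ≡ α (mod gJ n t J)`. -/
def theta {d : ℕ} (n : ℕ) (t : Fin d → ℕ) (α : ℤ) (J : Finset (Fin d)) (r : ℕ) : ℕ :=
  ((Fintype.piFinset fun _ : {ℓ : Fin d // ℓ ∉ J} => Finset.range r).filter
    fun a => (gJ n t J : ℤ) ∣ (∑ ℓ : {ℓ : Fin d // ℓ ∉ J}, (t ℓ.1 : ℤ) * a ℓ) - α).card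

/-- Number of lattice points of `𝒜^{(α)} = {a ∈ ℤ^d : ∑ t_ℓ a_ℓ ≡ α (mod n)}`
inside the box `∏_j [n·v(j), n·v(j) + w_j − 1]` where the width `w_j` is `n`
for `j ∈ J` and `r` for `j ∉ J`.  With `v = 0` this is `|C_J ∩ 𝒜^{(α)}|`,
and with `v = v_{J,s}` it is `|(C_J + n·v_{J,s}) ∩ 𝒜^{(α)}|`. -/
def cJcount {d : ℕ} (n : ℕ) (t : Fin d → ℕ) (α : ℤ) (J : Finset (Fin d)) (r : ℕ)
    (v : Fin d → ℕ) : ℕ :=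
  ((Fintype.piFinset fun j : Fin d =>
      Finset.Ico (n * v j) (n * v j + if j ∈ J then n else r)).filter
    fun a => (n : ℤ) ∣ (∑ ℓ, (t ℓ : ℤ) * a ℓ) - α).card

/-- The hom `x ↦ ∑ j, t j * x j` on tuples of residues modulo `n`. -/
def weightedSumHom {ι : Type*} [Fintype ι] (n : ℕ) (t : ι → ℕ) : (ι → ZMod n) →+ ZMod n where
  toFun x := ∑ j, (t j : ZMod n) * x j
  map_zero' := by simp
  map_add' x y := by simp [mul_add, Finset.sum_add_distrib]

theorem range_weightedSumHom {ι : Type*} [Fintype ι] (n : ℕ) (t : ι → ℕ) :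
    (weightedSumHom n t).range =
      AddSubgroup.zmultiples ((Nat.gcd (Finset.univ.gcd t) n : ℕ) : ZMod n) := by
  classical
  apply le_antisymm
  · rintro _ ⟨x, rfl⟩
    refine AddSubgroup.sum_mem _ fun j _ => ?_
    obtain ⟨c, hc⟩ : Nat.gcd (Finset.univ.gcd t) n ∣ t j :=
      (Nat.gcd_dvd_left _ _).trans (Finset.gcd_dvd (Finset.mem_univ j))
    obtain ⟨z, hz⟩ := ZMod.intCast_surjective (x j)
    refine AddSubgroup.mem_zmultiples_iff.2 ⟨c * z, ?_⟩
    rw [hc, ← hz]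
    push_cast [zsmul_eq_mul]
    ring
  · rw [AddSubgroup.zmultiples_le]
    obtain ⟨m, hm⟩ := Int.subgroup_cyclic
      ((weightedSumHom n t).range.comap (Int.castAddHom (ZMod n)))
    rw [← AddSubgroup.zmultiples_eq_closure] at hm
    have key (z : ℤ) : (z : ZMod n) ∈ (weightedSumHom n t).range ↔ m ∣ z := by
      rw [← Int.mem_zmultiples_iff, ← hm]
      rfl
    have hn : m ∣ n := by
      rw [← key, Int.cast_natCast, ZMod.natCast_self]
      exact zero_mem _
    have ht (j : ι) : m ∣ t j := by
      rw [← key]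
      exact ⟨Pi.single j 1, by simp [weightedSumHom, Pi.single_apply]⟩
    rw [← Int.cast_natCast, key, ← Int.natAbs_dvd_natAbs, Int.natAbs_natCast]
    exact Nat.dvd_gcd (Finset.dvd_gcd fun j _ => Int.natAbs_dvd_natAbs.2 (ht j))
      (Int.natAbs_dvd_natAbs.2 hn)

theorem mul_card_weightedSum_eq {ι : Type*} [Fintype ι] [DecidableEq ι] {n : ℕ} (hn : n ≠ 0)
    (t : ι → ℕ) (β : ℤ) :
    n * ((Fintype.piFinset fun _ : ι => Finset.range n).filter
        fun a => (n : ℤ) ∣ (∑ j, (t j : ℤ) * a j) + β).card =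
      if ((Nat.gcd (Finset.univ.gcd t) n : ℕ) : ℤ) ∣ β then
        Nat.gcd (Finset.univ.gcd t) n * n ^ Fintype.card ι else 0 := by
  have : NeZero n := ⟨hn⟩
  set g := Nat.gcd (Finset.univ.gcd t) n with hg
  have hgn : g ∣ n := Nat.gcd_dvd_right _ _
  have hcard : ((Fintype.piFinset fun _ : ι => Finset.range n).filter
        fun a => (n : ℤ) ∣ (∑ j, (t j : ℤ) * a j) + β).card =
      (Finset.univ.filter fun x => weightedSumHom n t x = ((-β : ℤ) : ZMod n)).card := by
    refine Finset.card_nbij' (fun a j => (a j : ZMod n)) (fun x j => (x j).val) ?_ ?_ ?_ ?_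
    · intro a ha
      simp only [Finset.coe_filter, Set.mem_ofPred_eq, Finset.mem_univ, true_and] at ha ⊢
      have h := (ZMod.intCast_zmod_eq_zero_iff_dvd _ n).2 ha.2
      push_cast at h ⊢
      exact eq_neg_of_add_eq_zero_left h
    · intro x hx
      simp only [Finset.coe_filter, Set.mem_ofPred_eq, Finset.mem_univ, true_and,
        Fintype.mem_piFinset, Finset.mem_range] at hx ⊢
      refine ⟨fun j => ZMod.val_lt _, (ZMod.intCast_zmod_eq_zero_iff_dvd _ n).1 ?_⟩
      push_cast at hx ⊢
      simp only [ZMod.natCast_val, ZMod.cast_id', id_eq]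
      exact eq_neg_iff_add_eq_zero.1 hx
    · intro a ha
      simp only [Finset.coe_filter, Set.mem_ofPred_eq, Fintype.mem_piFinset,
        Finset.mem_range] at ha
      exact funext fun j => ZMod.val_cast_of_lt (ha.1 j)
    · intro x _
      exact funext fun j => ZMod.natCast_zmod_val (x j)
  have hmem : ((-β : ℤ) : ZMod n) ∈ (weightedSumHom n t).range ↔ (g : ℤ) ∣ β := by
    rw [range_weightedSumHom, AddSubgroup.mem_zmultiples_iff]
    constructor
    · rintro ⟨c, hc⟩
      have h : ((c * g + β : ℤ) : ZMod n) = 0 := by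
        rw [zsmul_eq_mul] at hc
        push_cast at hc ⊢
        rw [hc, neg_add_cancel]
      have h' := (Int.natCast_dvd_natCast.2 hgn).trans
        ((ZMod.intCast_zmod_eq_zero_iff_dvd _ n).1 h)
      exact (dvd_add_right (dvd_mul_left _ _)).1 h'
    · rintro ⟨c, rfl⟩
      exact ⟨-c, by push_cast [zsmul_eq_mul]; ring⟩
  rw [hcard]
  split_ifs with h
  · have hfib : (Finset.univ.filter fun x => weightedSumHom n t x = ((-β : ℤ) : ZMod n)).card =
        Nat.card (weightedSumHom n t).ker := by
      rw [AddMonoidHom.card_fiber_eq_of_mem_range (weightedSumHom n t) (hmem.2 h)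
        (zero_mem (weightedSumHom n t).range), Nat.card_eq_fintype_card, Fintype.card_subtype]
      simp only [AddMonoidHom.mem_ker]
    have hrange : Nat.card (weightedSumHom n t).range * g = n := by
      rw [range_weightedSumHom, Nat.card_zmultiples, ZMod.addOrderOf_coe _ hn, ← hg,
        Nat.gcd_eq_right hgn, Nat.div_mul_cancel hgn]
    have hker := (weightedSumHom n t).ker.card_mul_index
    rw [AddSubgroup.index_ker, Nat.card_fun, Nat.card_zmod,
      Nat.card_eq_fintype_card (α := ι)] at hker
    rw [hfib, ← hker]
    nth_rewrite 1 [← hrange]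
    ring
  · rw [Finset.card_eq_zero.2, mul_zero]
    exact Finset.filter_eq_empty_iff.2 fun x _ hx => h (hmem.1 ⟨x, hx⟩)

theorem cJcount_eq_cJcount_zero {d : ℕ} (n : ℕ) (t : Fin d → ℕ) (α : ℤ) (J : Finset (Fin d))
    (r : ℕ) (v : Fin d → ℕ) : cJcount n t α J r v = cJcount n t α J r fun _ => 0 := by
  have key (a : Fin d → ℕ) : (n : ℤ) ∣ (∑ j, (t j : ℤ) * ((n * v j + a j : ℕ) : ℤ)) - α ↔
      (n : ℤ) ∣ (∑ j, (t j : ℤ) * a j) - α := by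
    have : (∑ j, (t j : ℤ) * ((n * v j + a j : ℕ) : ℤ)) - α =
        n * (∑ j, (t j : ℤ) * v j) + ((∑ j, (t j : ℤ) * a j) - α) := by
      push_cast
      rw [Finset.mul_sum, ← add_sub_assoc, ← Finset.sum_add_distrib]
      congr 1
      exact Finset.sum_congr rfl fun j _ => by ring
    rw [this, dvd_add_right (dvd_mul_right _ _)]
  symm
  refine Finset.card_nbij' (fun a j => n * v j + a j) (fun a j => a j - n * v j) ?_ ?_ ?_ ?_
  · intro a ha
    simp only [Finset.coe_filter, Set.mem_ofPred_eq, Fintype.mem_piFinset, Finset.mem_Ico] at ha ⊢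
    exact ⟨fun j => by have := ha.1 j; omega, (key a).2 ha.2⟩
  · intro a ha
    simp only [Finset.coe_filter, Set.mem_ofPred_eq, Fintype.mem_piFinset, Finset.mem_Ico] at ha ⊢
    refine ⟨fun j => by have := ha.1 j; omega, (key _).1 ?_⟩
    convert ha.2 using 6 with j
    have := ha.1 j
    omega
  · intro a _
    simp
  · intro a ha
    simp only [Finset.coe_filter, Set.mem_ofPred_eq, Fintype.mem_piFinset, Finset.mem_Ico] at ha
    funext j
    have := ha.1 j
    show n * v j + (a j - n * v j) = a j
    omega

theorem cJcount_zero_eq_sum {d : ℕ} (n : ℕ) (t : Fin d → ℕ) (α : ℤ) (J : Finset (Fin d))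
    (r : ℕ) : cJcount n t α J r (fun _ => 0) =
      ∑ b ∈ Fintype.piFinset fun _ : {ℓ : Fin d // ℓ ∉ J} => Finset.range r,
        ((Fintype.piFinset fun _ : {j : Fin d // j ∈ J} => Finset.range n).filter
          fun a => (n : ℤ) ∣ (∑ j, (t j.1 : ℤ) * a j) +
            ((∑ ℓ, (t ℓ.1 : ℤ) * b ℓ) - α)).card := by
  rw [cJcount, ← Finset.card_sigma]
  have key (a : Fin d → ℕ) : (∑ j, (t j : ℤ) * a j) - α =
      (∑ j : {j // j ∈ J}, (t j.1 : ℤ) * a j) +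
        ((∑ ℓ : {ℓ // ℓ ∉ J}, (t ℓ.1 : ℤ) * a ℓ) - α) := by
    rw [← Fintype.sum_subtype_add_sum_subtype (· ∈ J), add_sub_assoc]
    congr!
  refine Finset.card_nbij' (fun a => ⟨fun ℓ => a ℓ, fun j => a j⟩)
    (fun p j => if h : j ∈ J then p.2 ⟨j, h⟩ else p.1 ⟨j, h⟩) ?_ ?_ ?_ ?_
  · intro a ha
    simp only [Finset.coe_filter, Set.mem_ofPred_eq, Fintype.mem_piFinset, Finset.mem_Ico,
      Finset.coe_sigma, Set.mem_sigma_iff, Finset.mem_coe, Finset.mem_range, key] at ha ⊢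
    refine ⟨fun ℓ => ?_, fun j => ?_, ha.2⟩
    · simpa [ℓ.2] using (ha.1 ℓ).2
    · simpa [j.2] using (ha.1 j).2
  · rintro ⟨b, a⟩ ha
    simp only [Finset.coe_filter, Set.mem_ofPred_eq, Fintype.mem_piFinset, Finset.mem_Ico,
      Finset.coe_sigma, Set.mem_sigma_iff, Finset.mem_coe, Finset.mem_range, key] at ha ⊢
    refine ⟨fun j => ?_, ?_⟩
    · by_cases h : j ∈ J
      · simpa [h] using ha.2.1 ⟨j, h⟩
      · simpa [h] using ha.1 ⟨j, h⟩
    · convert ha.2.2 using 2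
      · exact Finset.sum_congr rfl fun j _ => by simp
      · congr 1
        exact Finset.sum_congr rfl fun ℓ _ => by simp [ℓ.2]
  · intro a _
    funext j
    simp
  · rintro ⟨b, a⟩ _
    simp only [Finset.coe_mem, Sigma.mk.injEq, heq_eq_eq]
    refine ⟨?_, ?_⟩
    · funext ℓ
      simp [ℓ.2]
    · funext j
      simp

/-- Proposition 4.6 of the paper: for `N = kn + r` with `0 < r < n`, any
`J ⊆ {1,…,d}` and any `s : J → {0,…,k−1}` (so `v_{J,s}(j) = s(j)` for `j ∈ J`
and `k` for `j ∉ J`),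
`n·|(C_J + n·v_{J,s}) ∩ 𝒜^{(α)}| = n·|C_J ∩ 𝒜^{(α)}| = θ_J^{(α)}(r)·g_J·n^{|J|}`. -/
theorem stmt4 {d n : ℕ} (hd : 1 ≤ d) (hn : 2 ≤ n) (t : Fin d → ℕ)
    (hgcd : gJ n t Finset.univ = 1) (α : ℤ) (k r N : ℕ)
    (hr0 : 0 < r) (hrn : r < n) (hN : N = k * n + r)
    (J : Finset (Fin d)) (s : Fin d → ℕ) (hs : ∀ j ∈ J, s j < k) :
    n * cJcount n t α J r (fun j => if j ∈ J then s j else k) =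
        n * cJcount n t α J r (fun _ => 0) ∧
      n * cJcount n t α J r (fun _ => 0) =
        theta n t α J r * gJ n t J * n ^ J.card := by
  refine ⟨by rw [cJcount_eq_cJcount_zero], ?_⟩
  have hg : Nat.gcd (Finset.univ.gcd fun j : {j // j ∈ J} => t j) n = gJ n t J := by
    rw [gJ]
    congr 1
    refine Nat.dvd_antisymm ?_ ?_
    · exact Finset.dvd_gcd fun j hj =>
        Finset.gcd_dvd (f := fun j : {j // j ∈ J} => t j) (Finset.mem_univ ⟨j, hj⟩)
    · exact Finset.dvd_gcd fun j _ => Finset.gcd_dvd j.2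
  rw [cJcount_zero_eq_sum, Finset.mul_sum]
  simp_rw [mul_card_weightedSum_eq (show n ≠ 0 by omega) (fun j : {j // j ∈ J} => t j), hg]
  rw [← Finset.sum_filter, Finset.sum_const, smul_eq_mul, theta, mul_assoc, Fintype.card_coe]
end

section
/- Let N ≥ 1 be an integer with N ≡ 1 (mod 6). Then 6 times the number of quadruples (a₁,a₂,a₃,a₄) of integers with 0 ≤ a_ℓ ≤ N−1 for all ℓ and a₁ + a₂ + 3a₃ + 3a₄ ≡ 0 (mod 6) equals N⁴ + 2N² + 3. -/
open Finset

theorem sum_piFinset_fin_four (s : Finset ℕ) (f : ℕ → ℕ → ℕ → ℕ → ℕ) :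
    ∑ a ∈ Fintype.piFinset (fun _ : Fin 4 => s), f (a 0) (a 1) (a 2) (a 3) =
      ∑ x ∈ s, ∑ y ∈ s, ∑ z ∈ s, ∑ w ∈ s, f x y z w := by
  simp only [← Finset.sum_product']
  refine Finset.sum_bij' (fun a _ => (a 0, a 1, a 2, a 3))
    (fun p _ => ![p.1, p.2.1, p.2.2.1, p.2.2.2]) ?_ ?_ ?_ ?_ ?_
  · intro a ha
    simp_all [Fintype.mem_piFinset]
  · intro p hp
    simp_all [Fintype.mem_piFinset, Fin.forall_fin_succ]
  · intro a _
    ext i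
    fin_cases i <;> rfl
  · intro p _
    rfl
  · intro a _
    rfl

theorem sum_range_six_mul_add_one (f : ℕ → ℕ) (hf : ∀ a, f (a + 6) = f a) (k : ℕ) :
    ∑ a ∈ range (6 * k + 1), f a = k * ∑ a ∈ range 6, f a + f 0 := by
  induction k with
  | zero => simp
  | succ k ih =>
    rw [show 6 * (k + 1) + 1 = 6 + (6 * k + 1) by ring, sum_range_add]
    simp only [Nat.add_comm 6, hf, ih]
    ring

theorem sum_ite_six_dvd_add_three_mul (k s : ℕ) :
    ∑ a ∈ range (6 * k + 1), (if 6 ∣ s + 3 * a then 1 else 0) =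
      3 * k * (if 3 ∣ s then 1 else 0) + if 6 ∣ s then 1 else 0 := by
  rw [sum_range_six_mul_add_one (fun a => if 6 ∣ s + 3 * a then 1 else 0)
    fun a => if_congr (by omega) rfl rfl]
  have h : ∑ a ∈ range 6, (if 6 ∣ s + 3 * a then 1 else 0) = 3 * if 3 ∣ s then 1 else 0 := by
    simp only [sum_range_succ, range_zero, sum_empty]
    split_ifs <;> omega
  rw [h, Nat.mul_zero, Nat.add_zero]
  ring

theorem sum_ite_three_dvd_add_three_mul (n s : ℕ) :
    ∑ a ∈ range n, (if 3 ∣ s + 3 * a then 1 else 0) = n * if 3 ∣ s then 1 else 0 := by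
  simp [Nat.dvd_add_left]

theorem sum_ite_six_dvd_add (k s : ℕ) :
    ∑ a ∈ range (6 * k + 1), (if 6 ∣ s + a then 1 else 0) = k + if 6 ∣ s then 1 else 0 := by
  rw [sum_range_six_mul_add_one (fun a => if 6 ∣ s + a then 1 else 0)
    fun a => if_congr (by omega) rfl rfl]
  have h : ∑ a ∈ range 6, (if 6 ∣ s + a then 1 else 0) = 1 := by
    simp only [sum_range_succ, range_zero, sum_empty]
    split_ifs <;> omega
  simp [h]

theorem sum_ite_three_dvd_add (k s : ℕ) :
    ∑ a ∈ range (6 * k + 1), (if 3 ∣ s + a then 1 else 0) = 2 * k + if 3 ∣ s then 1 else 0 := by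
  rw [sum_range_six_mul_add_one (fun a => if 3 ∣ s + a then 1 else 0)
    fun a => if_congr (by omega) rfl rfl]
  have h : ∑ a ∈ range 6, (if 3 ∣ s + a then 1 else 0) = 2 := by
    simp only [sum_range_succ, range_zero, sum_empty]
    split_ifs <;> omega
  simp [h, Nat.mul_comm]

/-- Example 4.11 of the paper (the cyclic quotient singularity `1/6(1,1,3,3)`):
for `N ≡ 1 (mod 6)`,
`6 · #{(a₁,a₂,a₃,a₄) ∈ {0,…,N−1}⁴ : 6 ∣ a₁ + a₂ + 3a₃ + 3a₄} = N⁴ + 2N² + 3`. -/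
theorem stmt16 (N : ℕ) (hN : 1 ≤ N) (hmod : N ≡ 1 [MOD 6]) :
    6 * ((Fintype.piFinset fun _ : Fin 4 => Finset.range N).filter
        fun a => 6 ∣ a 0 + a 1 + 3 * a 2 + 3 * a 3).card =
      N ^ 4 + 2 * N ^ 2 + 3 := by
  obtain ⟨k, rfl⟩ : ∃ k, N = 6 * k + 1 := ⟨N / 6, by unfold Nat.ModEq at hmod; omega⟩
  rw [card_filter, sum_piFinset_fin_four _
    fun x y z w => if 6 ∣ x + y + 3 * z + 3 * w then 1 else 0]
  have h_six := sum_ite_six_dvd_add k 0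
  have h_three := sum_ite_three_dvd_add k 0
  simp only [Nat.zero_add, dvd_zero, if_true] at h_six h_three
  simp only [sum_ite_six_dvd_add_three_mul, sum_ite_three_dvd_add_three_mul, sum_ite_six_dvd_add,
    sum_ite_three_dvd_add, sum_add_distrib, ← mul_sum, sum_const, card_range, smul_eq_mul,
    h_six, h_three]
  ring
end
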